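/- arXiv:2108.01732 — 2 statements merged into one kernel-verified Lean document; each statement's English description precedes it below -/
import Mathlib

section
/- Let n ≥ 3 and let K ⊂ ℝ^n be a strictly convex body that is centrally symmetric with center at the origin, i.e., K = −K. Let x, y ∈ ℝ^n \ K with y ≠ x and suppose there exists p ∈ ℝ^n with C_y = p + C_x. Then y = −x and p = −2x; that is, the point y ≠ x and the vector p for which C_y is the translate of C_x by p are unique. -/
open Set Metric RealInnerProductSpace

noncomputable section

/-- Euclidean space ℝ^n. -/
abbrev Euc (n : ℕ) := EuclideanSpace ℝ (Fin n)

/-- The solid double-cone generated by a convex body `K` and a point `x`: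
the union of all lines through `x` and a point of `K`. -/
def solidCone {n : ℕ} (K : Set (Euc n)) (x : Euc n) : Set (Euc n) :=
  ⋃ y ∈ K, (affineSpan ℝ ({x, y} : Set (Euc n)) : Set (Euc n))

/-- The support double-cone of `K` with apex `x`: the topological frontier of
the solid double-cone. -/
def supportCone {n : ℕ} (K : Set (Euc n)) (x : Euc n) : Set (Euc n) :=
  frontier (solidCone K x)

/-- A convex body: a compact convex set with nonempty interior. -/
def IsConvexBody {n : ℕ} (K : Set (Euc n)) : Prop :=
  IsCompact K ∧ Convex ℝ K ∧ (interior K).Nonempty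

/-- `M` is the image of a topological embedding of the sphere `S^m ⊆ ℝ^(m+1)`
into ℝ^n: a continuous injective map from the unit sphere with range `M`
(such a map from the compact sphere is automatically a homeomorphism onto its
image). -/
def IsSphereEmbeddingImage {n : ℕ} (m : ℕ) (M : Set (Euc n)) : Prop :=
  ∃ f : Metric.sphere (0 : Euc (m + 1)) 1 → Euc n,
    Continuous f ∧ Function.Injective f ∧ Set.range f = M

/-- Closed convex pointed cone with nonempty interior. -/
structure PC {n : ℕ} (D : Set (Euc n)) : Prop where
  closed : IsClosed D
  convex : Convex ℝ D
  cone : ∀ t : ℝ, 0 ≤ t → ∀ z ∈ D, t • z ∈ D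
  pointed : ∀ z, z ∈ D → -z ∈ D → z = 0
  inter : (interior D).Nonempty

/-- The double cone on `D`. -/
def dbl {n : ℕ} (D : Set (Euc n)) : Set (Euc n) := {z | z ∈ D ∨ -z ∈ D}

/-- The opposite cone. -/
def opp {n : ℕ} (D : Set (Euc n)) : Set (Euc n) := {z | -z ∈ D}

lemma dbl_opp {n : ℕ} (D : Set (Euc n)) : dbl (opp D) = dbl D := by
  ext z; simp [dbl, opp, or_comm]

lemma opp_interior {n : ℕ} (D : Set (Euc n)) (z : Euc n) :
    z ∈ interior (opp D) ↔ -z ∈ interior D := by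
  have h := (Homeomorph.neg (Euc n)).preimage_interior D
  have h2 : (Homeomorph.neg (Euc n)) ⁻¹' D = opp D := by ext; simp [opp]
  rw [h2] at h
  rw [← h]; simp

lemma PC.opp {n : ℕ} {D : Set (Euc n)} (h : PC D) : PC (opp D) where
  closed := h.closed.preimage continuous_neg
  convex := by
    intro a ha b hb s t hs ht hst
    have := h.convex ha hb hs ht hst
    simp only [_root_.opp, mem_ofPred_eq] at *
    convert this using 1
    module
  cone := by
    intro t ht z hz
    have := h.cone t ht _ hz
    simpa [_root_.opp] using this
  pointed := by
    intro z h1 h2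
    simp only [_root_.opp, mem_ofPred_eq, neg_neg] at h1 h2
    exact h.pointed z h2 h1
  inter := by
    obtain ⟨z, hz⟩ := h.inter
    exact ⟨-z, by rw [opp_interior]; simpa using hz⟩

lemma PC.zero_mem {n : ℕ} {D : Set (Euc n)} (h : PC D) : (0 : Euc n) ∈ D := by
  obtain ⟨z, hz⟩ := h.inter
  simpa using h.cone 0 le_rfl z (interior_subset hz)

lemma PC.dir_mem {n : ℕ} {D : Set (Euc n)} (h : PC D) (d v : Euc n)
    (H : ∀ r : ℝ, 0 ≤ r → d + r • v ∈ D) : v ∈ D := by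
  have ht : Filter.Tendsto (fun r : ℝ => r⁻¹ • d + v) Filter.atTop (nhds ((0 : ℝ) • d + v)) :=
    (tendsto_inv_atTop_zero.smul_const d).add_const v
  rw [zero_smul, zero_add] at ht
  refine h.closed.mem_of_tendsto ht ?_
  filter_upwards [Filter.eventually_gt_atTop 0] with r hr
  have := h.cone r⁻¹ (by positivity) _ (H r hr.le)
  rwa [smul_add, smul_smul, inv_mul_cancel₀ hr.ne', one_smul] at this

lemma PC.exit {n : ℕ} {D : Set (Euc n)} (h : PC D) (d v : Euc n) (hv : v ≠ 0) :
    ∃ r : ℝ, d + r • v ∉ D := by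
  by_contra! H
  refine hv (h.pointed v (h.dir_mem d v fun r _ => H r) (h.dir_mem d (-v) fun r _ => ?_))
  simpa using H (-r)

lemma PC.exit_frontier {n : ℕ} {D : Set (Euc n)} (h : PC D) (d v : Euc n) (hd : d ∈ D)
    (hv : v ≠ 0) : ∃ r : ℝ, d + r • v ∈ frontier D := by
  have hc : Continuous (fun r : ℝ => d + r • v) := by fun_prop
  have : (frontier ((fun r : ℝ => d + r • v) ⁻¹' D)).Nonempty := by
    rw [nonempty_frontier_iff]
    refine ⟨⟨0, by simpa using hd⟩, fun H => ?_⟩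
    obtain ⟨r, hr⟩ := h.exit d v hv
    exact hr (H ▸ mem_univ r : r ∈ (fun r : ℝ => d + r • v) ⁻¹' D)
  obtain ⟨r, hr⟩ := this
  exact ⟨r, hc.frontier_preimage_subset D hr⟩

lemma interior_sub_dbl {n : ℕ} (D : Set (Euc n)) : interior D ⊆ interior (dbl D) :=
  interior_mono fun _ hz => Or.inl hz

lemma PC.dbl_closed {n : ℕ} {D : Set (Euc n)} (h : PC D) : IsClosed (dbl D) :=
  h.closed.union h.opp.closed

lemma PC.frontier_sub {n : ℕ} {D : Set (Euc n)} (h : PC D) (w : Euc n) (hw : w ∈ frontier D)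
    (h0 : w ≠ 0) : w ∈ frontier (dbl D) := by
  rw [h.closed.frontier_eq] at hw
  rw [h.dbl_closed.frontier_eq]
  refine ⟨Or.inl hw.1, fun hi => hw.2 ?_⟩
  rw [mem_interior_iff_mem_nhds] at hi ⊢
  have h2 : (_root_.opp D)ᶜ ∈ nhds w :=
    h.opp.closed.isOpen_compl.mem_nhds fun h' => h0 (h.pointed w hw.1 h')
  filter_upwards [hi, h2] with z hz hz2
  exact hz.resolve_right hz2

lemma exists_not_span {n : ℕ} (hn : 2 ≤ n) (O : Set (Euc n)) (hO : (interior O).Nonempty)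
    (q : Euc n) : ∃ d ∈ interior O, ∀ r : ℝ, d + r • q ≠ 0 := by
  by_contra! H
  have htop : Submodule.span ℝ {q} = ⊤ := by
    apply Submodule.eq_top_of_nonempty_interior'
    refine hO.mono (interior_maximal ?_ isOpen_interior)
    intro d hd
    obtain ⟨r, hr⟩ := H d hd
    rw [SetLike.mem_coe, Submodule.mem_span_singleton]
    exact ⟨-r, by rw [neg_smul]; exact (eq_neg_of_add_eq_zero_left hr).symm⟩
  have h1 := finrank_span_le_card (R := ℝ) ({q} : Set (Euc n))
  rw [htop, finrank_top, finrank_euclideanSpace_fin] at h1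
  simp at h1
  omega

lemma PC.zero_not_int {n : ℕ} (hn : 2 ≤ n) {D : Set (Euc n)} (h : PC D) :
    (0 : Euc n) ∉ interior D := by
  intro h0
  obtain ⟨d, _, hd⟩ := exists_not_span hn (univ : Set (Euc n)) ⟨0, by simp⟩ 0
  have hd0 : d ≠ 0 := by simpa using hd 0
  have ha : ∀ v : Euc n, v ∈ D := by
    intro v
    have ht : Filter.Tendsto (fun r : ℝ => r • v) (nhdsWithin 0 (Ioi 0)) (nhds ((0 : ℝ) • v)) :=
      ((continuous_id.smul continuous_const).tendsto (0 : ℝ)).mono_left nhdsWithin_le_nhds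
    rw [zero_smul] at ht
    have h2 : ∀ᶠ r in nhdsWithin (0 : ℝ) (Ioi 0), r • v ∈ D :=
      ht.eventually (mem_interior_iff_mem_nhds.1 h0)
    obtain ⟨r, hr, hr0⟩ := (h2.and self_mem_nhdsWithin).exists
    have hr0 : 0 < r := hr0
    have := h.cone r⁻¹ (by positivity) _ hr
    rwa [smul_smul, inv_mul_cancel₀ hr0.ne', one_smul] at this
  exact hd0 (h.pointed d (ha _) (ha _))

/-- If the double cones have equal frontiers and interiors of `A`, `B` meet, `A ⊆ B`. -/
lemma sub_of_meet {n : ℕ} (hn : 2 ≤ n) {A B : Set (Euc n)} (hA : PC A) (hB : PC B)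
    (hF : frontier (dbl A) = frontier (dbl B)) (hm : (interior A ∩ interior B).Nonempty) :
    A ⊆ B := by
  have hsub : interior A ⊆ interior B := by
    apply hA.convex.interior.isPreconnected.subset_left_of_subset_union isOpen_interior
      hB.closed.isOpen_compl
    · rw [Set.disjoint_left]
      intro z hz hz2
      exact hz2 (interior_subset hz)
    · intro z hz
      by_contra hcon
      simp only [mem_union, mem_compl_iff, not_or, not_not] at hcon
      have hf : z ∈ frontier B := by
        rw [hB.closed.frontier_eq]; exact ⟨hcon.2, hcon.1⟩
      have h0 : z ≠ 0 := fun h => hA.zero_not_int hn (h ▸ hz)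
      have h1 := hB.frontier_sub z hf h0
      rw [← hF] at h1
      exact h1.2 (interior_sub_dbl A hz)
    · exact hm
  rw [← hA.closed.closure_eq, ← hB.closed.closure_eq,
    ← hA.convex.closure_interior_eq_closure_of_nonempty_interior hA.inter]
  exact closure_mono (hsub.trans interior_subset)

lemma eq_of_meet {n : ℕ} (hn : 2 ≤ n) {A B : Set (Euc n)} (hA : PC A) (hB : PC B)
    (hF : frontier (dbl A) = frontier (dbl B)) (hm : (interior A ∩ interior B).Nonempty) :
    A = B :=
  (sub_of_meet hn hA hB hF hm).antisymm (sub_of_meet hn hB hA hF.symm (inter_comm _ _ ▸ hm))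

lemma separate {n : ℕ} {A B : Set (Euc n)} (hA : PC A) (hB : PC B)
    (hm : ¬ (interior A ∩ interior B).Nonempty) :
    ∃ f : StrongDual ℝ (Euc n), (∀ a ∈ interior A, f a < 0) ∧ ∀ b ∈ B, 0 ≤ f b := by
  have hd : Disjoint (interior A) B := by
    rw [Set.disjoint_left]
    intro z hz hzB
    rw [← hB.closed.closure_eq,
      ← hB.convex.closure_interior_eq_closure_of_nonempty_interior hB.inter] at hzB
    exact hm (_root_.mem_closure_iff.1 hzB _ isOpen_interior hz)
  obtain ⟨f, u, h1, h2⟩ := geometric_hahn_banach_open hA.convex.interior isOpen_interior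
    hB.convex hd
  have hu : u ≤ 0 := by simpa using h2 0 hB.zero_mem
  refine ⟨f, fun a ha => (h1 a ha).trans_le hu, fun b hb => ?_⟩
  by_contra! hneg
  have h3 := h2 _ (hB.cone ((u - 1) / f b) (div_nonneg_of_nonpos (by linarith) hneg.le) b hb)
  rw [map_smul, smul_eq_mul, div_mul_cancel₀ _ hneg.ne] at h3
  linarith

lemma common_kernel {n : ℕ} (hn : 3 ≤ n) (f g : StrongDual ℝ (Euc n)) :
    ∃ v : Euc n, v ≠ 0 ∧ f v = 0 ∧ g v = 0 := by
  let L : Euc n →ₗ[ℝ] ℝ × ℝ := (f : Euc n →ₗ[ℝ] ℝ).prod (g : Euc n →ₗ[ℝ] ℝ)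
  have hL : LinearMap.ker L ≠ ⊥ := by
    apply LinearMap.ker_ne_bot_of_finrank_lt
    simp
    omega
  obtain ⟨v, hv, hv0⟩ := Submodule.exists_mem_ne_zero_of_ne_bot hL
  have : L v = 0 := hv
  have h2 : (f v, g v) = (0, 0) := this
  exact ⟨v, hv0, (Prod.mk.inj h2).1, (Prod.mk.inj h2).2⟩

/-- Equal frontiers of double cones: the cones agree up to sign. -/
lemma eq_or_opp {n : ℕ} (hn : 3 ≤ n) {A B : Set (Euc n)} (hA : PC A) (hB : PC B)
    (hF : frontier (dbl A) = frontier (dbl B)) : A = B ∨ A = opp B := by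
  by_cases h1 : (interior A ∩ interior B).Nonempty
  · exact Or.inl (eq_of_meet (by omega) hA hB hF h1)
  by_cases h2 : (interior A ∩ interior (opp B)).Nonempty
  · exact Or.inr (eq_of_meet (by omega) hA hB.opp (by rw [dbl_opp]; exact hF) h2)
  exfalso
  obtain ⟨f, hf1, hf2⟩ := separate hA hB h1
  obtain ⟨g, hg1, hg2⟩ := separate hA hB.opp h2
  obtain ⟨v, hv, hfv, hgv⟩ := common_kernel hn f g
  obtain ⟨d, hd⟩ := hA.inter
  obtain ⟨r, hr⟩ := hA.exit_frontier d v (interior_subset hd) hv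
  have e1 : f (d + r • v) < 0 := by simpa [hfv] using hf1 d hd
  have e2 : g (d + r • v) < 0 := by simpa [hgv] using hg1 d hd
  have h0 : d + r • v ≠ 0 := by
    intro h; rw [h] at e1; simp at e1
  have hw := hA.frontier_sub _ hr h0
  rw [hF] at hw
  rcases hB.dbl_closed.frontier_subset hw with h | h
  · exact absurd (hf2 _ h) (not_le.2 e1)
  · exact absurd (hg2 _ h) (not_le.2 e2)

lemma frontier_dbl_smul {n : ℕ} {D : Set (Euc n)} (h : PC D) (t : ℝ) (ht : t ≠ 0) (z : Euc n)
    (hz : z ∈ frontier (dbl D)) : t • z ∈ frontier (dbl D) := by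
  have key : ∀ t : ℝ, ∀ z ∈ dbl D, t • z ∈ dbl D := by
    intro t z hz
    rcases le_total 0 t with h0 | h0
    · rcases hz with hz | hz
      · exact Or.inl (h.cone t h0 z hz)
      · exact Or.inr (by simpa using h.cone t h0 _ hz)
    · rcases hz with hz | hz
      · exact Or.inr (by simpa using h.cone (-t) (by linarith) z hz)
      · exact Or.inl (by simpa using h.cone (-t) (by linarith) _ hz)
  have h1 := (Homeomorph.smulOfNeZero (α := Euc n) t ht).preimage_frontier (dbl D)
  have h2 : (Homeomorph.smulOfNeZero (α := Euc n) t ht) ⁻¹' (dbl D) = dbl D := by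
    ext w
    refine ⟨fun hw => ?_, fun hw => key t w hw⟩
    have := key t⁻¹ _ hw
    simpa [smul_smul, inv_mul_cancel₀ ht] using this
  rw [h2] at h1
  rw [← h1] at hz
  exact hz

/-- The translation vector between frontiers of double cones is zero. -/
lemma trans_zero {n : ℕ} (hn : 2 ≤ n) {A B : Set (Euc n)} (hA : PC A) (hB : PC B) (q : Euc n)
    (H : ∀ z, z ∈ frontier (dbl B) ↔ z - q ∈ frontier (dbl A)) : q = 0 := by
  by_contra hq
  have key : ∀ s : ℝ, ∀ z ∈ frontier (dbl A), z + s • q ∈ frontier (dbl A) := by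
    intro s z hz
    have hpos : |s| + 1 ≠ 0 := by positivity
    have hpos2 : s + (|s| + 1) ≠ 0 := by
      have := neg_abs_le s
      intro h; linarith
    set t' := |s| + 1
    set t := s + t' with ht
    have h1 : t⁻¹ • z + q ∈ frontier (dbl B) := by
      rw [H, add_sub_cancel_right]
      exact frontier_dbl_smul hA _ (inv_ne_zero hpos2) _ hz
    have h2 := frontier_dbl_smul hB t hpos2 _ h1
    have h3 := frontier_dbl_smul hB t'⁻¹ (inv_ne_zero hpos) _ h2
    rw [H] at h3
    have h4 := frontier_dbl_smul hA t' hpos _ h3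
    convert h4 using 1
    rw [smul_sub, smul_smul, mul_inv_cancel₀ hpos, one_smul, smul_add, smul_smul,
      mul_inv_cancel₀ hpos2, one_smul, ht]
    module
  obtain ⟨d, hd, hd2⟩ := exists_not_span hn A hA.inter q
  obtain ⟨r, hr⟩ := hA.exit_frontier d q (interior_subset hd) hq
  have h1 := key (-r) _ (hA.frontier_sub _ hr (hd2 r))
  have h2 : d + r • q + (-r) • q = d := by module
  rw [h2] at h1
  exact h1.2 (interior_sub_dbl A hd)

/-- The cone of directions from `x` to `K`. -/
def dirCone {n : ℕ} (K : Set (Euc n)) (x : Euc n) : Set (Euc n) :=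
  {z | ∃ t : ℝ, 0 ≤ t ∧ ∃ k ∈ K, z = t • (k - x)}

lemma dirCone_PC {n : ℕ} {K : Set (Euc n)} (hK : IsConvexBody K) {x : Euc n} (hx : x ∉ K) :
    PC (dirCone K x) where
  closed := by
    obtain ⟨hc, -, hne⟩ := hK
    have hKne : K.Nonempty := hne.mono interior_subset
    have hδ : 0 < infDist x K := (hc.isClosed.notMem_iff_infDist_pos hKne).1 hx
    set δ := infDist x K
    have hk : ∀ k ∈ K, δ ≤ ‖k - x‖ := by
      intro k hk
      rw [← dist_eq_norm, dist_comm]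
      exact infDist_le_dist_of_mem hk
    refine isClosed_of_closure_subset fun z hz => ?_
    let R := (‖z‖ + 1) / δ
    let P : Set (Euc n) := (fun u : ℝ × Euc n => u.1 • (u.2 - x)) '' (Icc 0 R ×ˢ K)
    have hP : IsClosed P :=
      ((isCompact_Icc.prod hc).image (by fun_prop)).isClosed
    have hPD : P ⊆ dirCone K x := by
      rintro _ ⟨⟨t, k⟩, ⟨ht, hk⟩, rfl⟩
      exact ⟨t, ht.1, k, hk, rfl⟩
    apply hPD
    rw [← hP.closure_eq]
    rw [_root_.mem_closure_iff] at hz ⊢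
    intro o ho hzo
    obtain ⟨w, ⟨hw1, hw2⟩, hw3⟩ := hz (o ∩ ball z 1) (ho.inter isOpen_ball)
      ⟨hzo, mem_ball_self one_pos⟩
    refine ⟨w, hw1, ?_⟩
    obtain ⟨t, ht, k, hkK, rfl⟩ := hw3
    refine ⟨(t, k), ⟨⟨ht, ?_⟩, hkK⟩, rfl⟩
    change t ≤ (‖z‖ + 1) / δ
    rw [le_div_iff₀ hδ]
    rw [mem_ball, dist_eq_norm] at hw2
    have h1 : ‖t • (k - x)‖ ≤ ‖t • (k - x) - z‖ + ‖z‖ := by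
      simpa using norm_add_le (t • (k - x) - z) z
    rw [norm_smul, Real.norm_of_nonneg ht] at h1
    have h2 := mul_le_mul_of_nonneg_left (hk k hkK) ht
    linarith
  convex := by
    rintro _ ⟨t, ht, k, hk, rfl⟩ _ ⟨s, hs, l, hl, rfl⟩ a b ha hb hab
    rcases (add_nonneg (mul_nonneg ha ht) (mul_nonneg hb hs)).eq_or_lt' with h | h
    · have h1 : a * t = 0 := by nlinarith [mul_nonneg ha ht, mul_nonneg hb hs]
      have h2 : b * s = 0 := by nlinarith [mul_nonneg ha ht, mul_nonneg hb hs]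
      refine ⟨0, le_rfl, k, hk, ?_⟩
      rw [smul_smul, smul_smul, h1, h2]; simp
    · refine ⟨a * t + b * s, h.le, (a * t / (a * t + b * s)) • k + (b * s / (a * t + b * s)) • l,
        hK.2.1 hk hl (by positivity) (by positivity) (by field_simp), ?_⟩
      rw [smul_sub (a * t + b * s), smul_add (a * t + b * s), smul_smul (a * t + b * s),
        smul_smul (a * t + b * s), mul_div_cancel₀ _ h.ne', mul_div_cancel₀ _ h.ne']
      module
  cone := by
    rintro t ht _ ⟨s, hs, k, hk, rfl⟩
    exact ⟨t * s, by positivity, k, hk, by rw [smul_smul]⟩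
  pointed := by
    rintro z ⟨t, ht, k, hk, rfl⟩ ⟨s, hs, l, hl, h⟩
    by_contra hne
    have ht0 : t ≠ 0 := by rintro rfl; simp at hne
    have htp : 0 < t := lt_of_le_of_ne ht ht0.symm
    apply hx
    have hxe : x = (t / (t + s)) • k + (s / (t + s)) • l := by
      have h1 : (t + s) • x = t • k + s • l := by
        have h2 : t • (k - x) + s • (l - x) = 0 := by rw [← h]; simp
        rw [← sub_eq_zero, ← neg_eq_zero, ← h2]
        module
      have hts : t + s ≠ 0 := by positivity
      calc x = (t + s)⁻¹ • ((t + s) • x) := by rw [smul_smul, inv_mul_cancel₀ hts, one_smul]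
        _ = _ := by rw [h1, smul_add, smul_smul, smul_smul, div_eq_inv_mul, div_eq_inv_mul]
    rw [hxe]
    exact hK.2.1 hk hl (by positivity) (by positivity) (by field_simp)
  inter := by
    obtain ⟨k, hk⟩ := hK.2.2
    have h1 := (Homeomorph.addRight x).preimage_interior K
    refine ⟨k - x, interior_mono (s := (Homeomorph.addRight x) ⁻¹' K) ?_ ?_⟩
    · intro z hz
      exact ⟨1, zero_le_one, z + x, hz, by simp⟩
    · rw [← h1]; simpa using hk

lemma mem_line_iff {n : ℕ} (x k w : Euc n) :
    w ∈ affineSpan ℝ ({x, k} : Set (Euc n)) ↔ ∃ r : ℝ, r • (k - x) + x = w := by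
  have h := vadd_left_mem_affineSpan_pair (k := ℝ) (p₁ := x) (p₂ := k) (v := w - x)
  simp only [vadd_eq_add, sub_add_cancel, vsub_eq_sub] at h
  rw [h]
  simp only [eq_sub_iff_add_eq]

lemma supportCone_mem {n : ℕ} (K : Set (Euc n)) (x z : Euc n) :
    z ∈ supportCone K x ↔ z - x ∈ frontier (dbl (dirCone K x)) := by
  have h1 := (Homeomorph.subRight x).preimage_frontier (dbl (dirCone K x))
  have h2 : (Homeomorph.subRight x) ⁻¹' (dbl (dirCone K x)) = solidCone K x := by
    ext w
    simp only [solidCone, mem_iUnion, SetLike.mem_coe, mem_line_iff,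
      AffineMap.lineMap_apply, vsub_eq_sub, vadd_eq_add, mem_preimage, dbl, mem_ofPred_eq,
      Homeomorph.coe_subRight, dirCone]
    constructor
    · rintro (⟨t, ht, k, hk, h⟩ | ⟨t, ht, k, hk, h⟩)
      · exact ⟨k, hk, t, by rw [← h]; simp⟩
      · exact ⟨k, hk, -t, by rw [neg_smul, ← h]; simp⟩
    · rintro ⟨k, hk, r, rfl⟩
      rcases le_total 0 r with h | h
      · exact Or.inl ⟨r, h, k, hk, by simp⟩
      · exact Or.inr ⟨-r, by linarith, k, hk, by simp⟩
  rw [h2] at h1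
  rw [supportCone, ← h1]; simp

lemma dirCone_step {n : ℕ} {K : Set (Euc n)} {x y : Euc n}
    (h : dirCone K x = dirCone K y) (w : Euc n) (hw : w ∈ dirCone K x) (h0 : w ≠ 0) (hD : PC (dirCone K x)) :
    ∃ t : ℝ, 0 < t ∧ w - t • (y - x) ∈ dirCone K x := by
  obtain ⟨t, ht, k, hk, rfl⟩ := hw
  have ht0 : t ≠ 0 := by rintro rfl; simp at h0
  refine ⟨t, lt_of_le_of_ne ht ht0.symm, ?_⟩
  have h1 : k - y ∈ dirCone K x := by
    rw [h]; exact ⟨1, zero_le_one, k, hk, by simp⟩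
  convert hD.cone t ht _ h1 using 1
  module

lemma dirCone_inj {n : ℕ} (hn : 2 ≤ n) {K : Set (Euc n)} {x y : Euc n}
    (h : dirCone K x = dirCone K y) (hD : PC (dirCone K x)) : x = y := by
  by_contra hne
  have hv : y - x ≠ 0 := sub_ne_zero.2 (Ne.symm hne)
  obtain ⟨d, hd, hd2⟩ := exists_not_span hn _ hD.inter (y - x)
  obtain ⟨r, hr⟩ := hD.exit d (y - x) hv
  have hc : Continuous (fun r : ℝ => d + r • (y - x)) := by fun_prop
  let A : Set ℝ := (fun r : ℝ => d + r • (y - x)) ⁻¹' dirCone K x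
  have hAconv : Convex ℝ A := by
    intro a ha b hb s t hs ht hst
    have := hD.convex ha hb hs ht hst
    change d + (s • a + t • b) • (y - x) ∈ dirCone K x
    convert this using 1
    have : t = 1 - s := by linarith
    subst this
    simp only [smul_eq_mul]
    module
  have hAo : IsOpen A := by
    rw [isOpen_iff_mem_nhds]
    intro a ha
    obtain ⟨t, ht, h1⟩ := dirCone_step h _ ha (hd2 a) hD
    obtain ⟨s, hs, h2⟩ := dirCone_step h.symm _ (h ▸ ha) (hd2 a) (h ▸ hD)
    rw [← h] at h2
    have h1' : a - t ∈ A := by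
      change d + (a - t) • (y - x) ∈ dirCone K x
      convert h1 using 1
      module
    have h2' : a + s ∈ A := by
      change d + (a + s) • (y - x) ∈ dirCone K x
      convert h2 using 1
      module
    exact Filter.mem_of_superset (Icc_mem_nhds (by linarith) (by linarith))
      (hAconv.ordConnected.out h1' h2')
  have hA : A = univ := IsClopen.eq_univ ⟨hD.closed.preimage hc, hAo⟩
    ⟨0, by simpa [A] using interior_subset hd⟩
  exact hr (hA ▸ mem_univ r : r ∈ A)

/-- If `K` is a strictly convex body with `K = -K`, `x, y ∉ K`,
`y ≠ x`, and `C_y = p + C_x`, then `y = -x` and `p = -2x`; i.e. the point `y`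
and the translation vector `p` are unique. -/
theorem stmt_12 (n : ℕ) (hn : 3 ≤ n) (K : Set (Euc n))
    (hK : IsConvexBody K) (hKs : StrictConvex ℝ K)
    (hsym : K = (fun z => -z) '' K)
    (x y : Euc n) (hx : x ∉ K) (hy : y ∉ K) (hxy : y ≠ x)
    (p : Euc n) (hp : supportCone K y = (fun z => p + z) '' supportCone K x) :
    y = -x ∧ p = -((2 : ℝ) • x) := by
  have hX := dirCone_PC hK hx
  have hY := dirCone_PC hK hy
  have H : ∀ z, z ∈ frontier (dbl (dirCone K y)) ↔
      z - (p + x - y) ∈ frontier (dbl (dirCone K x)) := by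
    intro z
    have h1 := supportCone_mem K y (z + y)
    rw [add_sub_cancel_right] at h1
    have h2 := supportCone_mem K x (z + y - p)
    have h3 : z + y - p - x = z - (p + x - y) := by abel
    rw [h3] at h2
    rw [← h1, ← h2, hp]
    constructor
    · rintro ⟨w, hw, h⟩
      rw [← h]; simpa using hw
    · intro h
      exact ⟨_, h, by simp⟩
  have hq := trans_zero (by omega) hX hY _ H
  rw [hq] at H
  have hF : frontier (dbl (dirCone K y)) = frontier (dbl (dirCone K x)) := by
    ext z; simpa using H z
  have hpe : p = y - x := by
    have : p - (y - x) = 0 := by rw [← hq]; abel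
    exact sub_eq_zero.1 this
  have hneg : ∀ k, k ∈ K → -k ∈ K := by
    intro k hk
    rw [hsym]; exact ⟨k, hk, rfl⟩
  have hopp : opp (dirCone K x) = dirCone K (-x) := by
    ext z
    constructor
    · rintro ⟨t, ht, k, hk, h⟩
      refine ⟨t, ht, -k, hneg k hk, ?_⟩
      rw [← neg_neg z, h]; module
    · rintro ⟨t, ht, k, hk, h⟩
      refine ⟨t, ht, -k, hneg k hk, ?_⟩
      rw [h]; module
  have hyx : y = -x := by
    rcases eq_or_opp hn hY hX hF with h | h
    · exact absurd (dirCone_inj (by omega) h hY) hxy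
    · rw [hopp] at h
      exact dirCone_inj (by omega) h hY
  refine ⟨hyx, ?_⟩
  rw [hpe, hyx]; module
end
end

section
/- Assume the Setting. Then there exist points u, v ∈ L with v ≠ u and a vector q ∈ ℝ^n such that C_v = q + C_u and the grazes Ω_u = C_u ∩ bd K and Ω_v = C_v ∩ bd K have equal diameters: diam Ω_u = diam Ω_v. -/
open Set Metric RealInnerProductSpace

noncomputable section

section Helpers

variable {E : Type*} [NormedAddCommGroup E] [NormedSpace ℝ E]

/-- The one-sided cone of directions from `x` to `K`. -/
def rcone (K : Set E) (x : E) : Set E :=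
  {v | ∃ t : ℝ, 0 ≤ t ∧ ∃ k ∈ K, v = t • (k - x)}

/-- The points of `K` whose ray from `x` misses the interior of `K`. -/
def grz (K : Set E) (x : E) : Set E :=
  {k | k ∈ K ∧ ∀ t : ℝ, 0 < t → x + t • (k - x) ∉ interior K}

/-- Closed pointed convex cones that are not trivial. -/
structure GoodCone (P : Set E) : Prop where
  closed : IsClosed P
  add : ∀ a ∈ P, ∀ b ∈ P, a + b ∈ P
  smul : ∀ t : ℝ, 0 ≤ t → ∀ a ∈ P, t • a ∈ P
  pos : ∃ f : E →L[ℝ] ℝ, ∀ v ∈ P, v ≠ 0 → 0 < f v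
  ne : ∃ p ∈ P, p ≠ 0

theorem closedM {M : Set (E × E)} (hM : IsCompact M) (h : ∀ q ∈ M, q.1 ≠ q.2) :
    IsClosed {q : E × E | ∃ t : ℝ, 0 ≤ t ∧ ∃ k, (q.1, k) ∈ M ∧ q.2 = t • (k - q.1)} := by
  rcases M.eq_empty_or_nonempty with rfl | hne
  · simp
  obtain ⟨q0, hq0, hmin⟩ := hM.exists_isMinOn hne
    (f := fun q : E × E => ‖q.2 - q.1‖) (by fun_prop)
  set δ := ‖q0.2 - q0.1‖ with hδ
  have hδ0 : 0 < δ := norm_pos_iff.2 (sub_ne_zero.2 (h q0 hq0).symm)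
  apply IsSeqClosed.isClosed
  intro u q hu hlim
  choose t ht k hk hw using hu
  have hb : Bornology.IsBounded (Set.range fun i => (u i).2) :=
    Metric.isBounded_range_of_tendsto _ ((continuous_snd.tendsto q).comp hlim)
  obtain ⟨R, hR⟩ := hb.exists_norm_le
  have hT : ∀ i, t i ∈ Set.Icc (0:ℝ) (R / δ) := by
    intro i
    refine ⟨ht i, ?_⟩
    rw [le_div_iff₀ hδ0]
    have h1 : ‖(u i).2‖ ≤ R := hR _ ⟨i, rfl⟩
    rw [hw i, norm_smul, Real.norm_of_nonneg (ht i)] at h1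
    have h2 : δ ≤ ‖k i - (u i).1‖ := hmin (hk i)
    exact (mul_le_mul_of_nonneg_left h2 (ht i)).trans h1
  have hc : IsCompact (Set.Icc (0:ℝ) (R / δ) ×ˢ M) := isCompact_Icc.prod hM
  obtain ⟨⟨t', x', k'⟩, hmem, φ, hφ, hl⟩ := hc.tendsto_subseq
    (x := fun i => (t i, ((u i).1, k i))) (fun i => ⟨hT i, hk i⟩)
  have hlt : Filter.Tendsto (fun i => t (φ i)) Filter.atTop (nhds t') :=
    (continuous_fst.tendsto _).comp hl
  have hlx : Filter.Tendsto (fun i => (u (φ i)).1) Filter.atTop (nhds x') :=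
    ((continuous_fst.comp continuous_snd).tendsto _).comp hl
  have hlk : Filter.Tendsto (fun i => k (φ i)) Filter.atTop (nhds k') :=
    ((continuous_snd.comp continuous_snd).tendsto _).comp hl
  have hq := hlim.comp hφ.tendsto_atTop
  have hq1 : Filter.Tendsto (fun i => (u (φ i)).1) Filter.atTop (nhds q.1) :=
    (continuous_fst.tendsto _).comp hq
  have hq2 : Filter.Tendsto (fun i => (u (φ i)).2) Filter.atTop (nhds q.2) :=
    (continuous_snd.tendsto _).comp hq
  have e1 : q.1 = x' := tendsto_nhds_unique hq1 hlx
  have e2 : q.2 = t' • (k' - x') := by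
    refine tendsto_nhds_unique hq2 ?_
    have := hlt.smul (hlk.sub hlx)
    refine this.congr fun i => (hw _).symm
  refine ⟨t', hmem.1.1, k', ?_, ?_⟩
  · rw [e1]; exact hmem.2
  · rw [e1]; exact e2

theorem rcone_closed {K : Set E} (hK : IsCompact K) {x : E} (hx : x ∉ K) :
    IsClosed (rcone K x) := by
  have h := closedM (M := {x} ×ˢ K) (isCompact_singleton.prod hK)
    (by rintro ⟨a, b⟩ ⟨ha, hb⟩ hab; simp only [Set.mem_singleton_iff] at *; subst ha; subst hab
        exact hx hb)
  have h2 := h.preimage (f := fun w : E => (x, w)) (by fun_prop)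
  convert h2 using 1
  ext w
  simp [rcone]

theorem rcone_good {K : Set E} (hK : IsCompact K) (hc : Convex ℝ K)
    {c : E} (hne : c ∈ K) {x : E} (hx : x ∉ K) : GoodCone (rcone K x) := by
  refine ⟨rcone_closed hK hx, ?_, ?_, ?_, ?_⟩
  · rintro _ ⟨s, hs, a, ha, rfl⟩ _ ⟨t, ht, b, hb, rfl⟩
    rcases eq_or_lt_of_le (add_nonneg hs ht) with h0 | h0
    · have : s = 0 := by linarith
      have : t = 0 := by linarith
      subst s t
      exact ⟨0, le_rfl, a, ha, by simp⟩
    · refine ⟨s + t, h0.le, (s / (s+t)) • a + (t/(s+t)) • b,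
        hc ha hb (by positivity) (by positivity) (by field_simp), ?_⟩
      have e1 : (s+t) * (s/(s+t)) = s := by field_simp
      have e2 : (s+t) * (t/(s+t)) = t := by field_simp
      rw [smul_sub (s+t), smul_add, smul_smul, smul_smul, e1, e2]
      module
  · rintro t ht _ ⟨s, hs, a, ha, rfl⟩
    exact ⟨t * s, by positivity, a, ha, by rw [smul_smul]⟩
  · obtain ⟨f, u, h1, h2⟩ := geometric_hahn_banach_point_closed hc hK.isClosed hx
    refine ⟨f, ?_⟩
    rintro _ ⟨s, hs, a, ha, rfl⟩ h0
    have hs' : 0 < s := lt_of_le_of_ne hs (by rintro rfl; simp at h0)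
    have := h2 a ha
    simp only [map_smul, map_sub, smul_eq_mul]
    exact mul_pos hs' (by linarith)
  · exact ⟨c - x, ⟨1, zero_le_one, c, hne, by simp⟩, sub_ne_zero.2 (by rintro rfl; exact hx hne)⟩

theorem mem_interior_rcone {K : Set E} {x v : E} {t : ℝ} (ht : 0 < t)
    (h : x + t • v ∈ interior K) : v ∈ interior (rcone K x) := by
  have ho : IsOpen ((fun v : E => x + t • v) ⁻¹' interior K) :=
    isOpen_interior.preimage (by fun_prop)
  refine interior_maximal ?_ ho h
  intro w hw
  refine ⟨t⁻¹, by positivity, _, interior_subset hw, ?_⟩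
  rw [add_sub_cancel_left, smul_smul, inv_mul_cancel₀ ht.ne', one_smul]

theorem ray_hits {K : Set E} (hc : Convex ℝ K) {x v c : E} (hci : c ∈ interior K) {s : ℝ}
    (hs : 0 < s) (h : v + s • (v - (c - x)) ∈ rcone K x) :
    ∃ t : ℝ, 0 < t ∧ x + t • v ∈ interior K := by
  obtain ⟨t, ht, k, hk, e⟩ := h
  have h0 : 0 < t + s := by linarith
  refine ⟨(1 + s) / (t + s), by positivity, ?_⟩
  have hm := hc.combo_interior_self_mem_interior hci hk (a := s / (t+s)) (b := t/(t+s))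
    (by positivity) (by positivity) (by field_simp; ring)
  convert hm using 1
  have e2 : (1 + s) • v = t • (k - x) + s • (c - x) := by rw [← e]; module
  have e3 : (t+s) • x + (1+s) • v = s • c + t • k := by rw [e2]; module
  have : (t+s)⁻¹ • ((t+s) • x + (1+s) • v) = (t+s)⁻¹ • (s • c + t • k) := by rw [e3]
  rw [smul_add, smul_add, smul_smul, smul_smul, smul_smul, smul_smul,
    inv_mul_cancel₀ h0.ne', one_smul] at this
  rw [div_eq_inv_mul, this, div_eq_inv_mul, div_eq_inv_mul]

theorem interior_rcone_hits {K : Set E} (hc : Convex ℝ K) {x v c : E} (hci : c ∈ interior K)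
    (h : v ∈ interior (rcone K x)) : ∃ t : ℝ, 0 < t ∧ x + t • v ∈ interior K := by
  have hcont : Filter.Tendsto (fun s : ℝ => v + s • (v - (c - x))) (nhds 0) (nhds v) := by
    have : Continuous (fun s : ℝ => v + s • (v - (c - x))) := by fun_prop
    simpa using this.tendsto 0
  have h1 := (hcont.mono_left (nhdsWithin_le_nhds (s := Set.Ioi 0))).eventually
    (mem_interior_iff_mem_nhds.1 h)
  obtain ⟨s, hs1, hs2⟩ := (h1.and self_mem_nhdsWithin).exists
  exact ray_hits hc hci hs2 hs1

/-- Interior of the double cone on the positive side. -/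
theorem interior_double {P : Set E} {f : E →L[ℝ] ℝ} (hf : ∀ v ∈ P, v ≠ 0 → 0 < f v) {v : E}
    (hv : 0 < f v) (h : v ∈ interior (P ∪ -P)) : v ∈ interior P := by
  rw [mem_interior_iff_mem_nhds] at h ⊢
  have h2 : {w : E | 0 < f w} ∈ nhds v := (isOpen_lt continuous_const f.continuous).mem_nhds hv
  filter_upwards [h, h2] with w hw hw2
  rcases hw with hw | hw
  · exact hw
  · by_cases h0 : w = 0
    · subst h0; simp at hw2
    · have := hf _ hw (neg_ne_zero.2 h0)
      simp only [map_neg] at this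
      have hw3 : 0 < f w := hw2
      linarith

theorem preconn_frontier {s S : Set E} (hs : IsPreconnected s) (h1 : (s ∩ S).Nonempty)
    (h2 : (s ∩ Sᶜ).Nonempty) : (s ∩ frontier S).Nonempty := by
  rw [frontier_eq_closure_inter_closure]
  refine isPreconnected_closed_iff.1 hs _ _ isClosed_closure isClosed_closure ?_ ?_ ?_
  · intro z _
    by_cases h : z ∈ S
    · exact Or.inl (subset_closure h)
    · exact Or.inr (subset_closure h)
  · exact h1.mono (Set.inter_subset_inter_right _ subset_closure)
  · exact h2.mono (Set.inter_subset_inter_right _ subset_closure)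

theorem GoodCone.neg {P : Set E} (h : GoodCone P) : GoodCone (-P) := by
  obtain ⟨f, hf⟩ := h.pos
  obtain ⟨p, hp, hp0⟩ := h.ne
  refine ⟨h.closed.neg, ?_, ?_, ⟨-f, ?_⟩, ⟨-p, by simpa using hp, neg_ne_zero.2 hp0⟩⟩
  · intro a ha b hb
    simp only [Set.mem_neg] at *
    rw [neg_add]; exact h.add _ ha _ hb
  · intro t ht a ha
    simp only [Set.mem_neg] at *
    rw [← smul_neg]; exact h.smul _ ht _ ha
  · intro v hv hv0
    have := hf _ hv (neg_ne_zero.2 hv0)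
    simpa using this

theorem GoodCone.dir {P : Set E} (h : GoodCone P) {p v : E}
    (hv : ∀ t : ℝ, 0 ≤ t → p + t • v ∈ P) : v ∈ P := by
  have h1 : Filter.Tendsto (fun i : ℕ => ((i:ℝ)+1)⁻¹ • p + v) Filter.atTop (nhds v) := by
    have : Filter.Tendsto (fun i : ℕ => ((i:ℝ)+1)⁻¹) Filter.atTop (nhds 0) := by
      simpa [one_div] using tendsto_one_div_add_atTop_nhds_zero_nat (𝕜 := ℝ)
    simpa using (this.smul_const p).add_const v
  refine h.closed.mem_of_tendsto h1 (Filter.Eventually.of_forall fun i => ?_)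
  have hi : (0:ℝ) < (i:ℝ) + 1 := by positivity
  have := h.smul ((i:ℝ)+1)⁻¹ (by positivity) _ (hv (i+1) hi.le)
  rwa [smul_add, smul_smul, inv_mul_cancel₀ hi.ne', one_smul] at this

/-- Leaving a cone along a direction not in the cone one meets the frontier. -/
theorem GoodCone.exit {P : Set E} (h : GoodCone P) {p v : E} (hp : p ∈ P) (hv : v ∉ P) :
    ∃ t : ℝ, 0 ≤ t ∧ p + t • v ∈ frontier P := by
  have h1 : ∃ t : ℝ, 0 ≤ t ∧ p + t • v ∉ P := by
    by_contra hcon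
    push Not at hcon
    exact hv (h.dir hcon)
  obtain ⟨t, ht, hout⟩ := h1
  have hpc : IsPreconnected ((fun s : ℝ => p + s • v) '' Set.Ici 0) :=
    isPreconnected_Ici.image _ (by fun_prop)
  obtain ⟨w, ⟨s, hs, rfl⟩, hw⟩ := preconn_frontier hpc (S := P)
    ⟨p, ⟨0, by simp, by simp⟩, hp⟩ ⟨_, ⟨t, ht, rfl⟩, hout⟩
  exact ⟨s, hs, hw⟩

theorem GoodCone.subset {P Q : Set E} (hP : GoodCone P) (hQ : GoodCone Q)
    (hD : frontier (P ∪ -P) = frontier (Q ∪ -Q)) {f : E →L[ℝ] ℝ}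
    (hfP : ∀ v ∈ P, v ≠ 0 → 0 < f v) (hfQ : ∀ v ∈ Q, v ≠ 0 → 0 < f v)
    {v : E} (hv : v ≠ 0) (hfv : f v = 0) : P ⊆ Q := by
  have key : ∀ d ∈ frontier P, 0 < f d → d ∈ Q := by
    intro d hd hfd
    have hdP : d ∈ P := hP.closed.frontier_subset hd
    have h1 : d ∈ frontier (P ∪ -P) := by
      refine ⟨subset_closure (Or.inl hdP), fun hi => hd.2 (interior_double hfP hfd hi)⟩
    rw [hD] at h1
    rcases (hQ.closed.union hQ.neg.closed).frontier_subset h1 with h2 | h2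
    · exact h2
    · by_cases h0 : d = 0
      · subst h0; simp at hfd
      · have := hfQ _ h2 (neg_ne_zero.2 h0)
        simp only [map_neg] at this
        linarith
  intro p hp
  by_cases h0 : p = 0
  · subst h0
    obtain ⟨q, hq, _⟩ := hQ.ne
    simpa using hQ.smul 0 le_rfl q hq
  have hfp := hfP p hp h0
  have n1 : v ∉ P := fun h => by have := hfP v h hv; linarith
  have n2 : -v ∉ P := fun h => by
    have := hfP _ h (neg_ne_zero.2 hv); simp only [map_neg] at this; linarith
  obtain ⟨s, hs, h1⟩ := hP.exit hp n1
  obtain ⟨t, ht, h2⟩ := hP.exit hp n2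
  have q1 := key _ h1 (by simp [hfv, hfp])
  have q2 := key _ h2 (by simp [hfv, hfp])
  rcases eq_or_lt_of_le hs with hs0 | hs0
  · subst hs0; simpa using q1
  have h0 : 0 < s + t := by linarith
  have := hQ.smul (s+t)⁻¹ (by positivity) _ (hQ.add _ (hQ.smul t ht _ q1) _ (hQ.smul s hs _ q2))
  have e : t • (p + s • v) + s • (p + t • -v) = (s + t) • p := by module
  rwa [e, smul_smul, inv_mul_cancel₀ h0.ne', one_smul] at this

theorem GoodCone.eq_of_pos {P Q : Set E} (hP : GoodCone P) (hQ : GoodCone Q)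
    (hD : frontier (P ∪ -P) = frontier (Q ∪ -Q)) {f : E →L[ℝ] ℝ}
    (hfQ : ∀ v ∈ Q, v ≠ 0 → 0 < f v) {v : E} (hv : v ≠ 0) (hfv : f v = 0)
    (hn : ∀ w ∈ P, w ≠ 0 → f w ≠ 0) {p0 : E} (hp0 : p0 ∈ P) (hf0 : 0 < f p0) : P = Q := by
  obtain ⟨g, hg⟩ := hP.pos
  have hp00 : p0 ≠ 0 := by rintro rfl; simp at hf0
  have hfP : ∀ w ∈ P, w ≠ 0 → 0 < f w := by
    intro w hw hw0
    by_contra hcon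
    have hneg : f w < 0 := lt_of_le_of_ne (not_lt.1 hcon) (hn w hw hw0)
    have hm : f p0 • w + (-f w) • p0 ∈ P :=
      hP.add _ (hP.smul _ hf0.le _ hw) _ (hP.smul _ (by linarith) _ hp0)
    have hz : f (f p0 • w + (-f w) • p0) = 0 := by
      simp only [map_add, map_smul, smul_eq_mul]; ring
    have hz0 : f p0 • w + (-f w) • p0 = 0 := by
      by_contra h0
      exact hn _ hm h0 hz
    have hgz : g (f p0 • w + (-f w) • p0) = 0 := by rw [hz0, map_zero]
    simp only [map_add, map_smul, smul_eq_mul] at hgz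
    have h1 := mul_pos hf0 (hg w hw hw0)
    have h2 := mul_pos (neg_pos.2 hneg) (hg p0 hp0 hp00)
    linarith
  exact (hP.subset hQ hD hfP hfQ hv hfv).antisymm (hQ.subset hP hD.symm hfQ hfP hv hfv)

theorem GoodCone.eq_or_neg [FiniteDimensional ℝ E] (hdim : 3 ≤ Module.finrank ℝ E)
    {P Q : Set E} (hP : GoodCone P) (hQ : GoodCone Q)
    (hD : frontier (P ∪ -P) = frontier (Q ∪ -Q)) : P = Q ∨ P = -Q := by
  obtain ⟨f, hf⟩ := hQ.pos
  obtain ⟨g, hg⟩ := hP.pos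
  have hker : LinearMap.ker ((f : E →ₗ[ℝ] ℝ).prod (g : E →ₗ[ℝ] ℝ)) ≠ ⊥ :=
    LinearMap.ker_ne_bot_of_finrank_lt (by simp; omega)
  obtain ⟨v, hvk, hv⟩ := Submodule.exists_mem_ne_zero_of_ne_bot hker
  have hvk' : f v = 0 ∧ g v = 0 := by simpa using hvk
  obtain ⟨hfv, hgv⟩ := hvk'
  have hH : IsPreconnected {w : E | f w = 0 ∧ w ≠ 0} := by
    have hr : 1 < Module.rank ℝ (LinearMap.ker (f : E →ₗ[ℝ] ℝ)) := by
      rw [← Module.finrank_eq_rank]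
      have h1 := LinearMap.finrank_range_add_finrank_ker (f : E →ₗ[ℝ] ℝ)
      have h2 : Module.finrank ℝ (LinearMap.range (f : E →ₗ[ℝ] ℝ)) ≤ 1 := by
        simpa using Submodule.finrank_le (LinearMap.range (f : E →ₗ[ℝ] ℝ))
      have : 1 < Module.finrank ℝ (LinearMap.ker (f : E →ₗ[ℝ] ℝ)) := by omega
      exact_mod_cast this
    have h3 := (isConnected_compl_singleton_of_one_lt_rank hr 0).isPreconnected.image
      (Subtype.val : LinearMap.ker (f : E →ₗ[ℝ] ℝ) → E) continuous_subtype_val.continuousOn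
    convert h3 using 1
    ext w
    constructor
    · rintro ⟨h1, h2⟩
      exact ⟨⟨w, by simpa using h1⟩, by simpa using h2, rfl⟩
    · rintro ⟨⟨w, hw⟩, h2, rfl⟩
      exact ⟨by simpa using hw, by simpa using h2⟩
  have hn : ∀ w ∈ P ∪ -P, w ≠ 0 → f w ≠ 0 := by
    intro w hw hw0 hfw
    obtain ⟨d, ⟨hd1, hd2⟩, hd⟩ := preconn_frontier hH (S := P ∪ -P) ⟨w, ⟨hfw, hw0⟩, hw⟩
      ⟨v, ⟨hfv, hv⟩, by
        rintro (h | h)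
        · have := hg _ h hv; linarith
        · have := hg _ h (neg_ne_zero.2 hv); simp only [map_neg] at this; linarith⟩
    rw [hD] at hd
    rcases (hQ.closed.union hQ.neg.closed).frontier_subset hd with h2 | h2
    · have := hf _ h2 hd2; linarith
    · have := hf _ h2 (neg_ne_zero.2 hd2); simp only [map_neg] at this; linarith
  obtain ⟨p0, hp0, hp00⟩ := hP.ne
  rcases lt_or_gt_of_ne (hn p0 (Or.inl hp0) hp00) with h | h
  · right
    have hD' : frontier (-P ∪ -(-P)) = frontier (Q ∪ -Q) := by
      rw [neg_neg, Set.union_comm, hD]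
    have := hP.neg.eq_of_pos hQ hD' hf hv hfv (fun w hw => hn w (Or.inr hw)) (p0 := -p0)
      (by simpa using hp0) (by simpa using h)
    rw [← this, neg_neg]
  · left
    exact hP.eq_of_pos hQ hD hf hv hfv (fun w hw => hn w (Or.inl hw)) hp0 h

theorem rcone_inj_aux {K : Set E} {x y : E} (hP : GoodCone (rcone K x))
    (h : rcone K x = rcone K y) (hw : y - x ∉ rcone K x) {e : E}
    (he : e ∈ interior (rcone K x)) (hes : e ∉ Submodule.span ℝ {y - x}) : False := by
  obtain ⟨t, ht, hd⟩ := hP.exit (interior_subset he) hw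
  set d := e + t • (y - x) with hd_def
  have hd0 : d ≠ 0 := by
    intro h0
    apply hes
    rw [Submodule.mem_span_singleton]
    refine ⟨-t, ?_⟩
    rw [neg_smul, eq_comm, ← add_eq_zero_iff_eq_neg]
    exact h0
  have hdP : d ∈ rcone K x := hP.closed.frontier_subset hd
  rw [h] at hdP
  obtain ⟨s, hs, k, hk, hds⟩ := hdP
  have hs0 : 0 < s := lt_of_le_of_ne hs (by rintro rfl; simp at hds; exact hd0 hds)
  have hkx : k - x ∈ rcone K x := ⟨1, zero_le_one, k, hk, by simp⟩
  apply hd.2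
  have hp : (s * t) • (k - x) ∈ rcone K x := hP.smul _ (by positivity) _ hkx
  have hst : 0 < t + s := by linarith
  have e1 : (t + s) • d - (s * t) • (k - x) = s • e := by
    have : t • d = (s * t) • (k - y) := by rw [hds, smul_smul, mul_comm]
    rw [add_smul, this, hd_def]; module
  have e2 : s⁻¹ • ((t + s) • d - (s * t) • (k - x)) = e := by
    rw [e1, smul_smul, inv_mul_cancel₀ hs0.ne', one_smul]
  have ho : IsOpen ((fun z : E => s⁻¹ • ((t + s) • z - (s * t) • (k - x))) ⁻¹'
      interior (rcone K x)) := isOpen_interior.preimage (by fun_prop)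
  refine interior_maximal ?_ ho (by simpa only [Set.mem_preimage, e2] using he)
  intro z hz
  have hz1 := hP.smul (t+s)⁻¹ (by positivity) _
    (hP.add _ (hP.smul s hs _ (interior_subset hz)) _ hp)
  rwa [smul_smul, mul_inv_cancel₀ hs0.ne', one_smul, sub_add_cancel, smul_smul,
    inv_mul_cancel₀ hst.ne', one_smul] at hz1

theorem rcone_inj [FiniteDimensional ℝ E] (hdim : 3 ≤ Module.finrank ℝ E)
    {K : Set E} (hK : IsCompact K) (hc : Convex ℝ K) (hi : (interior K).Nonempty)
    {x y : E} (hx : x ∉ K) (hy : y ∉ K) (h : rcone K x = rcone K y) : x = y := by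
  obtain ⟨c, hci⟩ := hi
  have hP := rcone_good hK hc (interior_subset hci) hx
  by_contra hne
  have hw0 : y - x ≠ 0 := sub_ne_zero.2 (Ne.symm hne)
  have hci' : c - x ∈ interior (rcone K x) :=
    mem_interior_rcone (t := 1) one_pos (by simpa using hci)
  have hex : ∃ e ∈ interior (rcone K x), e ∉ Submodule.span ℝ {y - x} := by
    by_contra hcon
    push Not at hcon
    have h1 : (interior ((Submodule.span ℝ {y - x} : Submodule ℝ E) : Set E)).Nonempty :=
      ⟨_, interior_maximal hcon isOpen_interior hci'⟩
    have h2 := Submodule.eq_top_of_nonempty_interior' _ h1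
    have h3 := finrank_span_singleton (K := ℝ) hw0
    rw [h2, finrank_top] at h3
    omega
  obtain ⟨e, he, hes⟩ := hex
  by_cases hw : y - x ∈ rcone K x
  · have hw' : x - y ∉ rcone K y := by
      rw [← h]
      intro h'
      obtain ⟨g, hg⟩ := hP.pos
      have h1 := hg _ hw hw0
      have h2 := hg _ h' (sub_ne_zero.2 hne)
      simp only [map_sub] at h1 h2
      linarith
    refine rcone_inj_aux (h ▸ hP) h.symm hw' (h ▸ he) ?_
    rw [← neg_sub y x, ← Set.neg_singleton, Submodule.span_neg]
    exact hes
  · exact rcone_inj_aux hP h hw he hes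

/-! ### Grazes -/

theorem grz_graph_compact {K L : Set E} (hK : IsCompact K) (hL : IsCompact L) :
    IsCompact {q : E × E | q.1 ∈ L ∧ q.2 ∈ grz K q.1} := by
  have hcl : IsClosed {q : E × E | ∀ t : ℝ, 0 < t → q.1 + t • (q.2 - q.1) ∉ interior K} := by
    simp only [Set.ofPred_forall]
    refine isClosed_iInter fun t => isClosed_iInter fun _ => ?_
    exact (isOpen_interior.preimage (f := fun q : E × E => q.1 + t • (q.2 - q.1))
      (by fun_prop)).isClosed_compl
  convert (hL.prod hK).inter_right hcl using 1
  ext q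
  simp [grz, and_assoc]

theorem rcone_graph_closed {K L : Set E} (hK : IsCompact K) (hL : IsCompact L)
    (hKL : ∀ x ∈ L, x ∉ K) :
    IsClosed {q : E × E | q.1 ∈ L ∧ q.2 ∈ rcone K q.1} := by
  have := closedM (M := L ×ˢ K) (hL.prod hK)
    (by rintro ⟨a, b⟩ ⟨h1, h2⟩ h3; simp only at h1 h2 h3; subst h3; exact hKL _ h1 h2)
  convert this using 1
  ext q
  simp only [rcone, Set.mem_prod, Set.mem_ofPred_eq]
  constructor
  · rintro ⟨h1, t, ht, k, hk, e⟩
    exact ⟨t, ht, k, ⟨h1, hk⟩, e⟩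
  · rintro ⟨t, ht, k, ⟨h1, hk⟩, e⟩
    exact ⟨h1, t, ht, k, hk, e⟩

/-- Lower semicontinuity of the graze. -/
theorem grz_lower {K L : Set E} (hK : IsCompact K) (hc : Convex ℝ K) (hKs : StrictConvex ℝ K)
    (hi : (interior K).Nonempty) (hL : IsCompact L) (hKL : ∀ x ∈ L, x ∉ K) {x k : E} (hx : x ∈ L)
    (hk : k ∈ grz K x) {ε : ℝ} (hε : 0 < ε) :
    ∀ᶠ x' in nhdsWithin x L, ∃ k' ∈ grz K x', dist k k' < ε := by
  obtain ⟨c, hci⟩ := hi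
  have hxk : k ≠ x := by rintro rfl; exact hKL _ hx hk.1
  -- bad set
  set M : Set (E × E) := {q : E × E | q.1 ∈ L ∧ q.2 ∈ grz K q.1} ∩ {q | ε ≤ dist k q.2} with hMdef
  have hM : IsCompact M := (grz_graph_compact hK hL).inter_right
    (isClosed_le continuous_const (by fun_prop))
  have hMne : ∀ q ∈ M, q.1 ≠ q.2 := by
    rintro ⟨a, b⟩ ⟨⟨h1, h2⟩, _⟩ h3
    simp only at h1 h2 h3
    subst h3
    exact hKL _ h1 h2.1
  have hB := (closedM hM hMne).isOpen_compl
  have hnot : ((x, k - x) : E × E) ∈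
      {q : E × E | ∃ t : ℝ, 0 ≤ t ∧ ∃ k, (q.1, k) ∈ M ∧ q.2 = t • (k - q.1)}ᶜ := by
    rintro ⟨t, ht, k', ⟨⟨-, hk'⟩, hfar⟩, e⟩
    simp only at hk' e
    have hfar' : ε ≤ dist k k' := hfar
    have hkk : k ≠ k' := by rintro rfl; simp at hfar'; linarith
    have ht0 : 0 < t := lt_of_le_of_ne ht (by
      rintro rfl; rw [zero_smul, sub_eq_zero] at e; exact hxk e)
    have hmid := hKs hk.1 hk'.1 hkk (a := 1/2) (b := 1/2) (by norm_num) (by norm_num) (by norm_num)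
    refine hk'.2 (t / 2 + 1 / 2) (by positivity) ?_
    convert hmid using 1
    have : k = x + t • (k' - x) := by rw [← e]; abel
    rw [this]; module
  -- choose a neighbourhood
  obtain ⟨r, hr, hball⟩ := Metric.isOpen_iff.1 hB _ hnot
  -- choose s
  have hsm : ∀ᶠ s : ℝ in nhds 0, ‖s • (k - c)‖ < min (r / 2) (dist k x / 2) := by
    have h1 : Continuous fun s : ℝ => ‖s • (k - c)‖ := by fun_prop
    have h2 := h1.tendsto 0
    simp only [zero_smul, norm_zero] at h2
    exact h2.eventually (gt_mem_nhds (lt_min (by positivity) (by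
      have := dist_pos.2 hxk; positivity)))
  obtain ⟨s, hs, hs0, hs1⟩ := ((hsm.filter_mono (nhdsWithin_le_nhds (s := Set.Ioi 0))).and
    (Ioo_mem_nhdsGT (one_pos (α := ℝ)))).exists
  rw [lt_min_iff] at hs
  -- the outer point
  have hout : k - x + s • (k - c) ∉ rcone K x := by
    intro h
    obtain ⟨τ, hτ, hin⟩ := ray_hits hc (v := k - x) hci hs0
      (by convert h using 3; abel)
    exact hk.2 τ hτ hin
  have hcl := rcone_graph_closed hK hL hKL
  have hev1 : ∀ᶠ x' in nhds x, ¬ (x' ∈ L ∧ k - x' + s • (k - c) ∈ rcone K x') := by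
    have hf : Continuous fun x' : E => ((x', k - x' + s • (k - c)) : E × E) := by fun_prop
    exact (hcl.preimage hf).isOpen_compl.mem_nhds (fun h => hout h.2)
  have hev2 : ∀ᶠ x' in nhds x, dist x' x < min (r / 2) (dist k x / 2) :=
    Metric.ball_mem_nhds _ (lt_min (by positivity) (by
      have := dist_pos.2 hxk; positivity))
  filter_upwards [nhdsWithin_le_nhds hev1, nhdsWithin_le_nhds hev2, self_mem_nhdsWithin]
    with x' h1 h2 hx'
  rw [lt_min_iff] at h2
  have hG := rcone_good hK hc (interior_subset hci) (hKL _ hx')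
  have hinner : k - s • (k - c) ∈ interior K := by
    have := hc.combo_interior_self_mem_interior hci hk.1 (a := s) (b := 1 - s) hs0
      (by linarith) (by ring)
    convert this using 1
    module
  have hpc : IsPreconnected ((fun τ : ℝ => k - x' + τ • (k - c)) '' Set.Icc (-s) s) :=
    isPreconnected_Icc.image _ (by fun_prop)
  obtain ⟨w, ⟨τ, hτ, rfl⟩, hw⟩ := preconn_frontier hpc (S := rcone K x')
    ⟨_, ⟨-s, by constructor <;> linarith, rfl⟩,
      ⟨1, zero_le_one, _, interior_subset hinner, by module⟩⟩
    ⟨_, ⟨s, by constructor <;> linarith, rfl⟩, fun h => h1 ⟨hx', h⟩⟩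
  have hτn : ‖τ • (k - c)‖ ≤ ‖s • (k - c)‖ := by
    rw [norm_smul, norm_smul, Real.norm_of_nonneg hs0.le]
    exact mul_le_mul_of_nonneg_right (abs_le.2 hτ) (norm_nonneg _)
  obtain ⟨t, ht, k', hk', e⟩ := hG.closed.frontier_subset hw
  simp only at e
  have ht0 : 0 < t := by
    refine lt_of_le_of_ne ht ?_
    rintro rfl
    rw [zero_smul] at e
    have h3 : k - x = (x' - x) - τ • (k - c) := by
      have : k - x = (k - x' + τ • (k - c)) + ((x' - x) - τ • (k - c)) := by abel
      rw [this, e, zero_add]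
    have h4 : dist k x ≤ ‖x' - x‖ + ‖τ • (k - c)‖ := by
      rw [dist_eq_norm, h3]; exact norm_sub_le _ _
    rw [← dist_eq_norm] at h4
    linarith [h2.2, hs.2]
  have hkg : k' ∈ grz K x' := by
    refine ⟨hk', fun θ hθ hin => hw.2 ?_⟩
    simp only
    rw [e]
    refine mem_interior_rcone (t := θ / t) (by positivity) ?_
    rw [smul_smul, div_mul_cancel₀ _ ht0.ne']
    exact hin
  refine ⟨k', hkg, ?_⟩
  by_contra hfar
  have hin : ((x', k - x' + τ • (k - c)) : E × E) ∈ Metric.ball ((x, k - x) : E × E) r := by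
    rw [Metric.mem_ball, Prod.dist_eq, max_lt_iff]
    refine ⟨by simp only; linarith [h2.1], ?_⟩
    simp only
    rw [dist_eq_norm]
    have : k - x' + τ • (k - c) - (k - x) = -(x' - x) + τ • (k - c) := by abel
    rw [this]
    have h5 := norm_add_le (-(x' - x)) (τ • (k - c))
    rw [norm_neg, ← dist_eq_norm x' x] at h5
    linarith [h2.1, hs.1]
  exact hball hin ⟨t, ht, k', ⟨⟨hx', hkg⟩, not_lt.1 hfar⟩, e⟩

theorem grz_compact {K : Set E} (hK : IsCompact K) (x : E) : IsCompact (grz K x) := by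
  have h := (grz_graph_compact hK (isCompact_singleton (x := x))).image continuous_snd
  convert h using 1
  ext k
  simp

theorem grz_upper {K L : Set E} (hK : IsCompact K) (hL : IsCompact L) {x : E} {ε : ℝ}
    (hε : 0 < ε) :
    ∀ᶠ x' in nhdsWithin x L, grz K x' ⊆ Metric.thickening ε (grz K x) := by
  have hB : IsCompact ({q : E × E | q.1 ∈ L ∧ q.2 ∈ grz K q.1} ∩
      {q | q.2 ∈ (Metric.thickening ε (grz K x))ᶜ}) :=
    (grz_graph_compact hK hL).inter_right
      (Metric.isOpen_thickening.isClosed_compl.preimage continuous_snd)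
  have hO := (hB.image continuous_fst).isClosed.isOpen_compl
  have hx : x ∈ (Prod.fst '' ({q : E × E | q.1 ∈ L ∧ q.2 ∈ grz K q.1} ∩
      {q | q.2 ∈ (Metric.thickening ε (grz K x))ᶜ}))ᶜ := by
    rintro ⟨⟨a, k⟩, ⟨⟨h1, h2⟩, h3⟩, h4⟩
    simp only at h4
    subst h4
    exact h3 (Metric.self_subset_thickening hε _ h2)
  filter_upwards [nhdsWithin_le_nhds (hO.mem_nhds hx), self_mem_nhdsWithin] with x' h1 hx' k hk
  by_contra hcon
  exact h1 ⟨(x', k), ⟨⟨hx', hk⟩, hcon⟩, rfl⟩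

theorem diam_grz_continuousOn {K L : Set E} (hK : IsCompact K) (hc : Convex ℝ K)
    (hKs : StrictConvex ℝ K)
    (hi : (interior K).Nonempty) (hL : IsCompact L) (hKL : ∀ x ∈ L, x ∉ K) :
    ContinuousOn (fun x => Metric.diam (grz K x)) L := by
  intro x hx
  refine tendsto_order.2 ⟨fun a ha => ?_, fun a ha => ?_⟩
  · rcases lt_or_ge a 0 with h0 | h0
    · exact Filter.Eventually.of_forall fun x' => h0.trans_le Metric.diam_nonneg
    have h1 : ∃ p ∈ grz K x, ∃ q ∈ grz K x, a < dist p q := by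
      by_contra hcon
      push Not at hcon
      exact absurd (Metric.diam_le_of_forall_dist_le h0 hcon) (not_le.2 ha)
    obtain ⟨p, hp, q, hq, hpq⟩ := h1
    have hε : 0 < (dist p q - a) / 2 := by linarith
    filter_upwards [grz_lower hK hc hKs hi hL hKL hx hp hε, grz_lower hK hc hKs hi hL hKL hx hq hε]
    rintro x' ⟨p', hp', hpp⟩ ⟨q', hq', hqq⟩
    have h2 := Metric.dist_le_diam_of_mem (grz_compact hK x').isBounded hp' hq'
    have h3 := dist_triangle4 p p' q' q
    rw [dist_comm q' q] at h3
    linarith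
  · have hε : 0 < (a - Metric.diam (grz K x)) / 4 := by linarith
    filter_upwards [grz_upper hK hL (x := x) hε] with x' hx'
    have h1 := Metric.diam_mono hx' (grz_compact hK x).isBounded.thickening
    have h2 := Metric.diam_thickening_le (grz K x) hε.le
    linarith

end Helpers

theorem mem_solidCone {n : ℕ} {K : Set (Euc n)} {x w : Euc n} :
    w ∈ solidCone K x ↔ w - x ∈ rcone K x ∪ -rcone K x := by
  simp only [solidCone, Set.mem_iUnion, SetLike.mem_coe, mem_affineSpan_pair_iff_exists_lineMap_eq,
    AffineMap.lineMap_apply, vsub_eq_sub, vadd_eq_add, exists_prop]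
  constructor
  · rintro ⟨k, hk, t, rfl⟩
    rcases le_total 0 t with ht | ht
    · exact Or.inl ⟨t, ht, k, hk, by simp⟩
    · exact Or.inr ⟨-t, by linarith, k, hk, by simp⟩
  · rintro (⟨t, ht, k, hk, e⟩ | ⟨t, ht, k, hk, e⟩)
    · exact ⟨k, hk, t, by rw [← e]; abel⟩
    · exact ⟨k, hk, -t, by rw [neg_smul, ← e]; abel⟩

theorem mem_supportCone {n : ℕ} {K : Set (Euc n)} {x w : Euc n} :
    w ∈ supportCone K x ↔ w - x ∈ frontier (rcone K x ∪ -rcone K x) := by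
  have h := (Homeomorph.subRight x).preimage_frontier (rcone K x ∪ -rcone K x)
  have h2 : solidCone K x = (Homeomorph.subRight x) ⁻¹' (rcone K x ∪ -rcone K x) := by
    ext w
    rw [mem_solidCone]
    rfl
  rw [supportCone, h2, ← h]
  rfl

theorem frontier_cone_smul {n : ℕ} {K : Set (Euc n)} {x d : Euc n} {t : ℝ} (ht : 0 < t)
    (hd : d ∈ frontier (rcone K x ∪ -rcone K x)) :
    t • d ∈ frontier (rcone K x ∪ -rcone K x) := by
  have h := (Homeomorph.smulOfNeZero t⁻¹ (inv_ne_zero ht.ne')).preimage_frontier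
    (rcone K x ∪ -rcone K x)
  have hsm : ∀ s : ℝ, 0 < s → ∀ v ∈ rcone K x, s • v ∈ rcone K x := by
    rintro s hs _ ⟨r, hr, k, hk, rfl⟩
    exact ⟨s * r, by positivity, k, hk, by rw [smul_smul]⟩
  have hsm2 : ∀ s : ℝ, 0 < s → ∀ v ∈ rcone K x ∪ -rcone K x, s • v ∈ rcone K x ∪ -rcone K x := by
    rintro s hs v (hv | hv)
    · exact Or.inl (hsm s hs v hv)
    · refine Or.inr ?_
      rw [Set.mem_neg, ← smul_neg]
      exact hsm s hs _ hv
  have h2 : (Homeomorph.smulOfNeZero t⁻¹ (inv_ne_zero ht.ne')) ⁻¹' (rcone K x ∪ -rcone K x)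
      = rcone K x ∪ -rcone K x := by
    ext v
    constructor
    · intro hv
      have h3 : t⁻¹ • v ∈ rcone K x ∪ -rcone K x := hv
      have := hsm2 t ht _ h3
      rwa [smul_smul, mul_inv_cancel₀ ht.ne', one_smul] at this
    · intro hv
      exact hsm2 t⁻¹ (by positivity) _ hv
  rw [h2] at h
  rw [← h]
  change t⁻¹ • (t • d) ∈ frontier (rcone K x ∪ -rcone K x)
  rwa [smul_smul, inv_mul_cancel₀ ht.ne', one_smul]

theorem frontier_translate_aux {n : ℕ} {K : Set (Euc n)} {x y q : Euc n}
    (h : ∀ d ∈ frontier (rcone K x ∪ -rcone K x), q + d ∈ frontier (rcone K y ∪ -rcone K y)) :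
    frontier (rcone K x ∪ -rcone K x) ⊆ frontier (rcone K y ∪ -rcone K y) := by
  intro d hd
  have h1 : Filter.Tendsto (fun i : ℕ => ((i:ℝ)+1)⁻¹ • q + d) Filter.atTop (nhds d) := by
    have : Filter.Tendsto (fun i : ℕ => ((i:ℝ)+1)⁻¹) Filter.atTop (nhds 0) := by
      simpa [one_div] using tendsto_one_div_add_atTop_nhds_zero_nat (𝕜 := ℝ)
    simpa using (this.smul_const q).add_const d
  refine isClosed_frontier.mem_of_tendsto h1 (Filter.Eventually.of_forall fun i => ?_)
  have hi : (0:ℝ) < (i:ℝ) + 1 := by positivity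
  have := frontier_cone_smul (inv_pos.2 hi) (h _ (frontier_cone_smul hi hd))
  rwa [smul_add, smul_smul, inv_mul_cancel₀ hi.ne', one_smul] at this

theorem frontier_of_translate {n : ℕ} {K : Set (Euc n)} {x y p : Euc n}
    (h : supportCone K y = (fun z => p + z) '' supportCone K x) :
    frontier (rcone K y ∪ -rcone K y) = frontier (rcone K x ∪ -rcone K x) := by
  refine Set.Subset.antisymm (frontier_translate_aux (q := y - p - x) ?_)
    (frontier_translate_aux (q := p + x - y) ?_)
  · intro d hd
    have h1 : d + y ∈ supportCone K y := mem_supportCone.2 (by simpa using hd)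
    rw [h] at h1
    obtain ⟨z, hz, e⟩ := h1
    have hz' := mem_supportCone.1 hz
    simp only at e
    have : d = p + z - y := by rw [e]; abel
    convert hz' using 1
    rw [this]; abel
  · intro d hd
    have h1 : p + (d + x) ∈ supportCone K y := by
      rw [h]
      exact ⟨_, mem_supportCone.2 (by simpa using hd), rfl⟩
    convert mem_supportCone.1 h1 using 1
    abel

theorem graze_eq {n : ℕ} {K : Set (Euc n)} (hK : IsCompact K) (hc : Convex ℝ K) {c : Euc n}
    (hci : c ∈ interior K) {x : Euc n} (hx : x ∉ K) :
    supportCone K x ∩ frontier K = grz K x := by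
  have hG := rcone_good hK hc (interior_subset hci) hx
  ext k
  constructor
  · rintro ⟨h1, h2⟩
    refine ⟨hK.isClosed.frontier_subset h2, fun t ht hin => ?_⟩
    rw [mem_supportCone] at h1
    exact h1.2 (interior_mono Set.subset_union_left (mem_interior_rcone ht hin))
  · rintro ⟨hk, h⟩
    have hkx : k - x ∈ rcone K x := ⟨1, zero_le_one, k, hk, by simp⟩
    refine ⟨mem_supportCone.2 ⟨subset_closure (Or.inl hkx), fun hi => ?_⟩,
      subset_closure hk, fun hi => h 1 one_pos (by simpa using hi)⟩
    obtain ⟨f, hf⟩ := hG.pos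
    have hpos := hf _ hkx (sub_ne_zero.2 (by rintro rfl; exact hx hk))
    obtain ⟨t, ht, hin⟩ := interior_rcone_hits hc hci (interior_double hf hpos hi)
    exact h t ht hin

/-- In the Setting, there exist `u, v ∈ L` with `v ≠ u` such
that `C_v` is a translate of `C_u` and the grazes `Ω_u` and `Ω_v` have equal
diameters. -/
theorem stmt_14 (n : ℕ) (hn : 3 ≤ n) (K L : Set (Euc n))
    (hK : IsConvexBody K) (hKs : StrictConvex ℝ K)
    (hL : IsSphereEmbeddingImage (n - 1) L)
    (hcomp : ∃ z ∈ Lᶜ, Bornology.IsBounded (connectedComponentIn Lᶜ z) ∧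
      K ⊆ connectedComponentIn Lᶜ z)
    (hcone : ∀ x ∈ L, ∃ y ∈ L, y ≠ x ∧ ∃ p : Euc n,
      supportCone K y = (fun z => p + z) '' supportCone K x) :
    ∃ u ∈ L, ∃ v ∈ L, v ≠ u ∧
      (∃ q : Euc n, supportCone K v = (fun z => q + z) '' supportCone K u) ∧
      Metric.diam (supportCone K u ∩ frontier K) =
        Metric.diam (supportCone K v ∩ frontier K) := by
  obtain ⟨hKc, hKv, hKi⟩ := hK
  obtain ⟨c, hci⟩ := hKi
  have hcK := interior_subset hci
  have hKL : ∀ x ∈ L, x ∉ K := by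
    obtain ⟨z, -, -, hsub⟩ := hcomp
    intro x hx hxK
    exact connectedComponentIn_subset _ _ (hsub hxK) hx
  have hdim : 3 ≤ Module.finrank ℝ (Euc n) := by simpa using hn
  have hLL : IsCompact L ∧ IsPreconnected L ∧ L.Nonempty := by
    obtain ⟨f, hf, -, rfl⟩ := hL
    have hr : 1 < Module.rank ℝ (Euc (n - 1 + 1)) := by
      rw [← Module.finrank_eq_rank]
      have : 1 < Module.finrank ℝ (Euc (n - 1 + 1)) := by
        simp only [finrank_euclideanSpace, Fintype.card_fin]; omega
      exact_mod_cast this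
    have hsc := isConnected_sphere hr (0 : Euc (n - 1 + 1)) zero_le_one
    haveI : ConnectedSpace (Metric.sphere (0 : Euc (n - 1 + 1)) 1) :=
      isConnected_iff_connectedSpace.1 hsc
    haveI : CompactSpace (Metric.sphere (0 : Euc (n - 1 + 1)) 1) :=
      isCompact_iff_compactSpace.1 (isCompact_sphere _ _)
    exact ⟨isCompact_range hf, isPreconnected_range hf, Set.range_nonempty f⟩
  obtain ⟨hLc, hLp, hLn⟩ := hLL
  have hG : ∀ x ∈ L, GoodCone (rcone K x) := fun x hx => rcone_good hKc hKv hcK (hKL x hx)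
  -- the pairing
  have hpair : ∀ x ∈ L, ∃ y ∈ L, rcone K y = -rcone K x := by
    intro x hx
    obtain ⟨y, hy, hyx, p, hp⟩ := hcone x hx
    refine ⟨y, hy, ?_⟩
    rcases (hG y hy).eq_or_neg hdim (hG x hx) (frontier_of_translate hp) with h | h
    · exact absurd (rcone_inj hdim hKc hKv ⟨c, hci⟩ (hKL y hy) (hKL x hx) h) hyx
    · exact h
  set R : Set (Euc n × Euc n) := {q | q.1 ∈ L ∧ q.2 ∈ L ∧ rcone K q.2 = -rcone K q.1} with hR
  have hRc : IsCompact R := by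
    have hcl := rcone_graph_closed hKc hLc hKL
    have h1 : IsClosed {q : Euc n × Euc n | ∀ k ∈ K, q.1 ∈ L ∧ q.2 - k ∈ rcone K q.1} := by
      simp only [Set.ofPred_forall]
      refine isClosed_iInter fun k => isClosed_iInter fun _ => ?_
      exact hcl.preimage (f := fun q : Euc n × Euc n => (q.1, q.2 - k)) (by fun_prop)
    have h2 : IsClosed {q : Euc n × Euc n | ∀ k ∈ K, q.2 ∈ L ∧ q.1 - k ∈ rcone K q.2} := by
      simp only [Set.ofPred_forall]
      refine isClosed_iInter fun k => isClosed_iInter fun _ => ?_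
      exact hcl.preimage (f := fun q : Euc n × Euc n => (q.2, q.1 - k)) (by fun_prop)
    convert (hLc.prod hLc).inter_right (h1.inter h2) using 1
    ext ⟨x, y⟩
    constructor
    · rintro ⟨hx, hy, e⟩
      simp only at hx hy e
      refine ⟨⟨hx, hy⟩, fun k hk => ⟨hx, ?_⟩, fun k hk => ⟨hy, ?_⟩⟩
      · have : k - y ∈ rcone K y := ⟨1, zero_le_one, k, hk, by simp⟩
        rw [e] at this
        simpa using this
      · have : k - x ∈ rcone K x := ⟨1, zero_le_one, k, hk, by simp⟩
        simp only
        rw [e]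
        simpa using this
    · rintro ⟨⟨hx, hy⟩, ha, hb⟩
      simp only at hx hy
      refine ⟨hx, hy, Set.Subset.antisymm ?_ ?_⟩
      · rintro _ ⟨t, ht, k, hk, rfl⟩
        have := (hG x hx).smul t ht _ (ha k hk).2
        rw [Set.mem_neg, ← smul_neg, neg_sub]
        exact this
      · rintro v ⟨t, ht, k, hk, e⟩
        have := (hG y hy).smul t ht _ (hb k hk).2
        have e' : v = t • (x - k) := by rw [← neg_neg v, e, ← smul_neg, neg_sub]
        rw [e']
        exact this
  have hgc := diam_grz_continuousOn hKc hKv hKs ⟨c, hci⟩ hLc hKL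
  set g : Euc n → ℝ := fun x => Metric.diam (grz K x) with hg
  have hg1 : ContinuousOn (fun q : Euc n × Euc n => g q.1) R :=
    hgc.comp continuous_fst.continuousOn (fun q hq => hq.1)
  have hg2 : ContinuousOn (fun q : Euc n × Euc n => g q.2) R :=
    hgc.comp continuous_snd.continuousOn (fun q hq => hq.2.1)
  have hA : IsCompact {q ∈ R | g q.1 ≤ g q.2} :=
    hRc.of_isClosed_subset (hRc.isClosed.isClosed_le hg1 hg2) (Set.sep_subset _ _)
  have hB : IsCompact {q ∈ R | g q.2 ≤ g q.1} :=
    hRc.of_isClosed_subset (hRc.isClosed.isClosed_le hg2 hg1) (Set.sep_subset _ _)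
  have hA' := (hA.image continuous_fst).isClosed
  have hB' := (hB.image continuous_fst).isClosed
  have hsymm : ∀ x y, (x, y) ∈ R → (y, x) ∈ R := by
    rintro x y ⟨h1, h2, h3⟩
    refine ⟨h2, h1, ?_⟩
    simp only at h3 ⊢
    rw [h3, neg_neg]
  have hx0 : ∃ x y, (x, y) ∈ R ∧ g x ≤ g y := by
    obtain ⟨x, hx⟩ := hLn
    obtain ⟨y, hy, e⟩ := hpair x hx
    have hxy : (x, y) ∈ R := ⟨hx, hy, e⟩
    rcases le_total (g x) (g y) with h | h
    · exact ⟨x, y, hxy, h⟩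
    · exact ⟨y, x, hsymm _ _ hxy, h⟩
  obtain ⟨x0, y0, hxy0, hle0⟩ := hx0
  obtain ⟨u, huL, ⟨⟨u1, v⟩, ⟨huv, hle⟩, e1⟩, ⟨⟨u2, v'⟩, ⟨huv', hle'⟩, e2⟩⟩ :=
    isPreconnected_closed_iff.1 hLp _ _ hA' hB'
      (by
        intro x hx
        obtain ⟨y, hy, e⟩ := hpair x hx
        have hxy : (x, y) ∈ R := ⟨hx, hy, e⟩
        rcases le_total (g x) (g y) with h | h
        · exact Or.inl ⟨(x, y), ⟨hxy, h⟩, rfl⟩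
        · exact Or.inr ⟨(x, y), ⟨hxy, h⟩, rfl⟩)
      ⟨x0, hxy0.1, (x0, y0), ⟨hxy0, hle0⟩, rfl⟩
      ⟨y0, hxy0.2.1, (y0, x0), ⟨hsymm _ _ hxy0, hle0⟩, rfl⟩
  simp only at e1 e2 hle hle'
  subst e1 e2
  obtain ⟨-, hv, ev⟩ := huv
  obtain ⟨-, hv', ev'⟩ := huv'
  simp only at hv hv' ev ev'
  have hvv : v' = v := rcone_inj hdim hKc hKv ⟨c, hci⟩ (hKL _ hv') (hKL _ hv) (ev'.trans ev.symm)
  subst hvv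
  refine ⟨u2, huL, v', hv, ?_, ⟨v' - u2, ?_⟩, ?_⟩
  · rintro rfl
    obtain ⟨f, hf⟩ := (hG _ hv).pos
    obtain ⟨p, hp, hp0⟩ := (hG _ hv).ne
    have h1 := hf p hp hp0
    rw [ev] at hp
    have h2 := hf _ hp (neg_ne_zero.2 hp0)
    simp only [map_neg] at h2
    linarith
  · ext w
    rw [mem_supportCone, ev, neg_neg, Set.union_comm]
    constructor
    · intro h
      refine ⟨w - (v' - u2), ?_, by simp⟩
      rw [mem_supportCone]
      convert h using 1
      abel
    · rintro ⟨z, hz, rfl⟩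
      rw [mem_supportCone] at hz
      convert hz using 1
      module
  · rw [graze_eq hKc hKv hci (hKL _ huL), graze_eq hKc hKv hci (hKL _ hv)]
    exact le_antisymm hle hle'
end
end
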